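/- Let χ be an even Dirichlet character modulo N (N > 2) and let n ≥ 1 be an integer. Then L(2n, χ) = (π^{2n} / (2(2n−1)! N^{2n})) · ∑_{i=1}^{n} a_{n,i} · L_{ℤ/Nℤ}(i, χ). -/

import Mathlib

open Finset Filter Real

/-- The number of cyclic descents of a permutation `σ` of `{0, …, n-1}`, read cyclically:
positions `i` with `σ(i) > σ(i+1)`, indices mod `n`. -/
def cyclicDescents (n : ℕ) (σ : Equiv.Perm (Fin n)) : ℕ :=
  (Finset.univ.filter (fun i : Fin n => σ (finRotate n i) < σ i)).card

/-- The circular Eulerian number `Ā(n,l)`: the number of circular `n`-permutations with exactly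
`l` descents.  Each circular permutation has exactly `n` linear representatives (all with the
same number of cyclic descents), whence the division by `n`. -/
def circEulerian (n l : ℕ) : ℕ :=
  (Finset.univ.filter (fun σ : Equiv.Perm (Fin n) => cyclicDescents n σ = l)).card / n

/-- The coefficient `t(k,i) = (-1)^(k-i) 2^(2i) (k/(k+i)) C(k+i, k-i)` of the Chebyshev
polynomial of the first kind, with the convention `t(0,0) = 1/2`. -/
noncomputable def tCoeff (k i : ℕ) : ℝ :=
  if k = 0 ∧ i = 0 then 1 / 2
  else (-1) ^ (k - i) * 2 ^ (2 * i) * ((k : ℝ) / ((k : ℝ) + (i : ℝ))) *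
    (Nat.choose (k + i) (k - i) : ℝ)

/-- The coefficient `u(k,i) = (-1)^(k-i) 2^(2i) C(k+i, k-i)` of the Chebyshev polynomial of the
second kind. -/
noncomputable def uCoeff (k i : ℕ) : ℝ :=
  (-1) ^ (k - i) * 2 ^ (2 * i) * (Nat.choose (k + i) (k - i) : ℝ)

/-- `a_{n,i} = 2 ∑_{l=1}^{i} (-1)^(n-l) t(n-l, n-i) Ā(2n, l)`. -/
noncomputable def aCoeff (n i : ℕ) : ℝ :=
  2 * ∑ l ∈ Finset.Icc 1 i, (-1) ^ (n - l) * tCoeff (n - l) (n - i) *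
    (circEulerian (2 * n) l : ℝ)

/-- `b_{n,i} = ∑_{l=1}^{i} (-1)^(n-l) u(n-l, n-i) Ā(2n+1, l)`. -/
noncomputable def bCoeff (n i : ℕ) : ℝ :=
  ∑ l ∈ Finset.Icc 1 i, (-1) ^ (n - l) * uCoeff (n - l) (n - i) *
    (circEulerian (2 * n + 1) l : ℝ)

namespace CircE

lemma cd_eq (n : ℕ) (σ : Equiv.Perm (Fin (n+1))) :
    cyclicDescents (n+1) σ = (Finset.univ.filter (fun i : Fin (n+1) => σ (i+1) < σ i)).card := by
  simp [cyclicDescents]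

lemma cd_rot (n : ℕ) (σ : Equiv.Perm (Fin (n+1))) (j : Fin (n+1)) :
    cyclicDescents (n+1) (σ * Equiv.addRight j) = cyclicDescents (n+1) σ := by
  rw [cd_eq, cd_eq]
  refine Finset.card_bij (fun i _ => i + j) ?_ ?_ ?_
  · intro i hi
    rw [Finset.mem_filter] at hi ⊢
    refine ⟨Finset.mem_univ _, ?_⟩
    have := hi.2
    simp only [Equiv.Perm.mul_apply, Equiv.coe_addRight] at this
    rwa [add_right_comm]
  · intro a _ b _ h
    exact add_right_cancel h
  · intro b hb
    refine ⟨b - j, ?_, by simp⟩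
    rw [Finset.mem_filter] at hb ⊢
    refine ⟨Finset.mem_univ _, ?_⟩
    have := hb.2
    simp only [Equiv.Perm.mul_apply, Equiv.coe_addRight]
    rw [add_right_comm]
    simpa using this

def C (n l : ℕ) : ℕ :=
  (Finset.univ.filter (fun σ : Equiv.Perm (Fin (n+1)) => cyclicDescents (n+1) σ = l)).card

def F (n l : ℕ) : ℕ :=
  (Finset.univ.filter
    (fun σ : Equiv.Perm (Fin (n+1)) => cyclicDescents (n+1) σ = l ∧ σ 0 = 0)).card

def D (n l : ℕ) : ℕ :=
  (Finset.univ.filter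
    (fun σ : Equiv.Perm (Fin (n+1)) => cyclicDescents (n+1) σ = l ∧ σ 0 < σ (Fin.last n))).card

lemma F_rot (n l : ℕ) (i : Fin (n+1)) :
    (Finset.univ.filter
      (fun σ : Equiv.Perm (Fin (n+1)) => cyclicDescents (n+1) σ = l ∧ σ i = 0)).card = F n l := by
  unfold F
  refine Finset.card_equiv (Equiv.mulRight (Equiv.addRight i)) ?_
  intro σ
  simp [cd_rot]

lemma D_rot (n l : ℕ) (i : Fin (n+1)) :
    (Finset.univ.filter
      (fun σ : Equiv.Perm (Fin (n+1)) => cyclicDescents (n+1) σ = l ∧ σ (i+1) < σ i)).card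
      = D n l := by
  unfold D
  refine Finset.card_equiv (Equiv.mulRight (Equiv.addRight (i+1))) ?_
  intro σ
  have : Fin.last n + (i + 1) = i := by
    rw [add_left_comm, Fin.last_add_one, add_zero]
  have h1 : (σ * Equiv.addRight (i+1)) (Fin.last n) = σ i := by
    exact congrArg σ this
  have h0 : (σ * Equiv.addRight (i+1)) 0 = σ (i+1) := by
    exact congrArg σ (zero_add _)
  simp only [Finset.mem_filter, Finset.mem_univ, true_and, Equiv.coe_mulRight, cd_rot, h0, h1]

lemma C_eq (n l : ℕ) : C n l = (n+1) * F n l := by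
  have h : ∑ i : Fin (n+1), (Finset.univ.filter
      (fun σ : Equiv.Perm (Fin (n+1)) => cyclicDescents (n+1) σ = l ∧ σ i = 0)).card
      = (n+1) * F n l := by
    simp [F_rot]
  rw [← h, C]
  simp_rw [Finset.card_filter]
  rw [Finset.sum_comm]
  refine Finset.sum_congr rfl fun σ _ => ?_
  rw [← Finset.card_filter]
  by_cases hσ : cyclicDescents (n+1) σ = l
  · simp only [hσ, true_and, if_true]
    symm
    rw [Finset.card_eq_one]
    refine ⟨σ.symm 0, ?_⟩
    ext i
    simp [Equiv.eq_symm_apply]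
  · simp [hσ]

lemma D_eq (n l : ℕ) : (n+1) * D n l = l * C n l := by
  have h : ∑ i : Fin (n+1), (Finset.univ.filter
      (fun σ : Equiv.Perm (Fin (n+1)) => cyclicDescents (n+1) σ = l ∧ σ (i+1) < σ i)).card
      = (n+1) * D n l := by
    simp [D_rot]
  rw [← h, C]
  simp_rw [Finset.card_filter]
  rw [Finset.sum_comm, Finset.mul_sum]
  refine Finset.sum_congr rfl fun σ _ => ?_
  rw [← Finset.card_filter]
  by_cases hσ : cyclicDescents (n+1) σ = l
  · simp only [hσ, true_and, if_true]
    rw [← cd_eq, hσ, mul_one]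
  · simp [hσ]

lemma circEulerian_eq (n l : ℕ) : circEulerian (n+1) l = F n l := by
  have : circEulerian (n+1) l = C n l / (n+1) := rfl
  rw [this, C_eq, Nat.mul_div_cancel_left _ (Nat.succ_pos n)]

def lin (n : ℕ) (τ : Equiv.Perm (Fin (n+1))) : ℕ :=
  (Finset.univ.filter (fun i : Fin n => τ i.succ < τ i.castSucc)).card

lemma cd_lin (n : ℕ) (τ : Equiv.Perm (Fin (n+1))) :
    cyclicDescents (n+1) τ = lin n τ + if τ 0 < τ (Fin.last n) then 1 else 0 := by
  rw [cd_eq, Finset.card_filter, Fin.sum_univ_castSucc, lin, Finset.card_filter]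
  simp

lemma cd_ins (n : ℕ) (τ : Equiv.Perm (Fin (n+1))) :
    cyclicDescents (n+2) (Equiv.Perm.decomposeFin.symm (0, τ)) = lin n τ + 1 := by
  rw [cd_lin, lin, Finset.card_filter, Fin.sum_univ_succ, lin, Finset.card_filter]
  rw [← Fin.succ_last]
  simp only [← Fin.succ_castSucc, Equiv.Perm.decomposeFin_symm_apply_succ, Fin.castSucc_zero,
    Equiv.Perm.decomposeFin_symm_apply_zero, Fin.succ_lt_succ_iff]
  simp

lemma F_lin (n l : ℕ) : F (n+1) l =
    (Finset.univ.filter (fun τ : Equiv.Perm (Fin (n+1)) => lin n τ + 1 = l)).card := by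
  unfold F
  symm
  refine Finset.card_bij (fun τ _ => Equiv.Perm.decomposeFin.symm (0, τ)) ?_ ?_ ?_
  · intro τ hτ
    simp only [Finset.mem_filter, Finset.mem_univ, true_and] at hτ ⊢
    rw [cd_ins]
    exact ⟨hτ, by simp⟩
  · intro a _ b _ h
    simpa using h
  · intro σ hσ
    simp only [Finset.mem_filter, Finset.mem_univ, true_and] at hσ
    obtain ⟨⟨p, τ⟩, rfl⟩ := Equiv.Perm.decomposeFin.symm.surjective σ
    have hp : p = 0 := by simpa using hσ.2
    subst hp
    refine ⟨τ, ?_, rfl⟩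
    simp only [Finset.mem_filter, Finset.mem_univ, true_and]
    rw [← cd_ins]; exact hσ.1

lemma F_zero (n : ℕ) : F (n+1) 0 = 0 := by
  rw [F_lin]; simp

lemma F_step (n l : ℕ) : F (n+1) (l+1) + D n l = D n (l+1) + C n l := by
  rw [F_lin, D, D, C]
  simp_rw [Finset.card_filter]
  rw [← Finset.sum_add_distrib, ← Finset.sum_add_distrib]
  refine Finset.sum_congr rfl fun τ _ => ?_
  have := cd_lin n τ
  split_ifs at this ⊢ <;> omega

lemma F_rec (n l : ℕ) :
    F (n+1) (l+1) + l * F n l = (l+1) * F n (l+1) + (n+1) * F n l := by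
  have h1 := F_step n l
  have h2 := D_eq n l
  have h3 := D_eq n (l+1)
  rw [C_eq] at h1 h2 h3
  have h4 : D n l = l * F n l := by
    apply Nat.eq_of_mul_eq_mul_left (Nat.succ_pos n)
    rw [Nat.succ_eq_add_one, h2]; ring
  have h5 : D n (l+1) = (l+1) * F n (l+1) := by
    apply Nat.eq_of_mul_eq_mul_left (Nat.succ_pos n)
    rw [Nat.succ_eq_add_one, h3]; ring
  rw [h4, h5] at h1
  exact h1

lemma F_base (l : ℕ) : F 0 l = if l = 0 then 1 else 0 := by
  have h : ∀ σ : Equiv.Perm (Fin 1), cyclicDescents 1 σ = 0 := by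
    intro σ
    rw [cd_lin]; simp [lin]
  unfold F
  have h2 : ∀ σ : Equiv.Perm (Fin 1), σ 0 = 0 := fun σ => Subsingleton.elim _ _
  simp only [zero_add, h, h2, and_true]
  split_ifs with hl
  · subst hl; simp
  · simp [Ne.symm hl]

lemma F_one (l : ℕ) : F 1 l = if l = 1 then 1 else 0 := by
  cases l with
  | zero => simp [F_zero]
  | succ l =>
    have := F_rec 0 l
    simp only [F_base] at this
    rcases l with _ | l
    · simpa using this
    · simpa using this

lemma F_large (n l : ℕ) (h : n + 2 ≤ l) : F (n+1) l = 0 := by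
  induction n generalizing l with
  | zero => rw [F_one]; simp; omega
  | succ n ih =>
    obtain ⟨l, rfl⟩ : ∃ k, l = k + 1 := ⟨l - 1, by omega⟩
    have := F_rec (n+1) l
    rw [ih l (by omega), ih (l+1) (by omega)] at this
    simpa using this

lemma F_symm (n a b : ℕ) (h : a + b = n + 2) : F (n+1) a = F (n+1) b := by
  induction n generalizing a b with
  | zero =>
    rw [F_one, F_one]
    congr 1
    simp; omega
  | succ n ih =>
    rcases a with _ | a
    · rw [F_zero, F_large _ _ (by omega)]
    rcases b with _ | b
    · rw [F_zero, F_large _ _ (by omega)]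
    have h1 := F_rec (n+1) a
    have h2 := F_rec (n+1) b
    rw [ih a (b+1) (by omega)] at h1
    rw [ih (a+1) b (by omega)] at h1
    have ha : a = n + 1 - b := by omega
    have hb : b ≤ n + 1 := by omega
    zify at h1 h2 ⊢
    have : (a : ℤ) = n + 1 - b := by omega
    rw [this] at h1
    linarith

end CircE
namespace CircB

noncomputable def v (k i : ℕ) : ℝ := (-1) ^ i * 4 ^ i * (Nat.choose (k + i) (2 * i) : ℝ)

lemma v_zero (k : ℕ) : v k 0 = 1 := by simp [v]

lemma v_rec (k i : ℕ) : v (k+2) (i+1) = -4 * v (k+1) i + 2 * v (k+1) (i+1) - v k (i+1) := by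
  have h : ((k + 2 + (i+1)).choose (2*(i+1)) : ℝ) + (k + (i+1)).choose (2*(i+1)) =
      (k + 1 + i).choose (2 * i) + 2 * (k + 1 + (i+1)).choose (2*(i+1)) := by
    have e1 : k + 2 + (i+1) = (k + i + 1) + 1 + 1 := by ring
    have e2 : 2*(i+1) = 2*i+1+1 := by ring
    have e3 : k + (i+1) = k+i+1 := by ring
    have e4 : k + 1 + i = k+i+1 := by ring
    have e5 : k + 1 + (i+1) = k+i+1+1 := by ring
    rw [e1, e2, e3, e4, e5]
    rw [Nat.choose_succ_succ (k+i+1+1) (2*i+1), Nat.choose_succ_succ (k+i+1) (2*i+1),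
      Nat.choose_succ_succ (k+i+1) (2*i)]
    push_cast
    ring
  have h' : ((k + 2 + (i+1)).choose (2*(i+1)) : ℝ) = (k + 1 + i).choose (2 * i)
      + 2 * (k + 1 + (i+1)).choose (2*(i+1)) - (k + (i+1)).choose (2*(i+1)) := by linarith
  unfold v
  rw [h']
  ring

lemma v_large (k i : ℕ) (h : k < i) : v k i = 0 := by
  unfold v
  rw [Nat.choose_eq_zero_of_lt (by omega)]
  simp

noncomputable def W (k : ℕ) (y : ℝ) : ℝ := ∑ i ∈ Finset.range (k+1), v k i * y ^ i

lemma W_ext (k M : ℕ) (y : ℝ) (h : k + 1 ≤ M) : ∑ i ∈ Finset.range M, v k i * y ^ i = W k y := by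
  unfold W
  symm
  apply Finset.sum_subset
  · intro x; simp; omega
  · intro x _ hx
    rw [v_large _ _ (by simpa using hx)]; simp

lemma W_rec (k : ℕ) (y : ℝ) : W (k+2) y = (2 - 4 * y) * W (k+1) y - W k y := by
  have h1 := W_ext (k+2) (k+3) y (by omega)
  have h2 := W_ext (k+1) (k+3) y (by omega)
  have h3 := W_ext k (k+3) y (by omega)
  have h4 := W_ext (k+1) (k+2) y (by omega)
  rw [sub_mul]
  rw [← h1, ← h3]
  nth_rw 1 [← h2]
  rw [← h4]
  rw [Finset.sum_range_succ' _ (k+2), Finset.sum_range_succ' _ (k+2), Finset.sum_range_succ' _ (k+2)]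
  simp_rw [v_rec, v_zero]
  simp only [mul_add, add_mul, sub_mul, Finset.sum_add_distrib, Finset.sum_sub_distrib,
    Finset.mul_sum, pow_succ]
  have : ∀ f g : ℕ → ℝ, (∀ i, f i = g i) → ∑ i ∈ Finset.range (k+2), f i
    = ∑ i ∈ Finset.range (k+2), g i := fun f g h => by simp [h]
  rw [this (fun i => -4 * v (k+1) i * (y^i * y)) (fun i => -(4 * y * (v (k+1) i * y ^ i)))
    (fun i => by ring)]
  rw [this (fun i => 2 * v (k+1) (i+1) * (y^i * y)) (fun i => (2 * (v (k+1) (i+1) * (y ^ i * y))))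
    (fun i => by ring)]
  rw [Finset.sum_neg_distrib]
  ring

lemma W_cos (θ : ℝ) (k : ℕ) :
    W (k+1) (Real.sin θ ^ 2) + W k (Real.sin θ ^ 2) = 2 * Real.cos (2 * (k+1) * θ) := by
  have hc : 2 - 4 * Real.sin θ ^ 2 = 2 * Real.cos (2 * θ) := by
    rw [Real.cos_two_mul, Real.cos_sq']; ring
  have w0 : ∀ y, W 0 y = 1 := by intro y; simp [W, v]
  have w1 : ∀ y, W 1 y = 1 - 4 * y := by
    intro y; simp [W, v, Finset.sum_range_succ]; ring
  have key : ∀ k : ℕ, (W (k+1) (Real.sin θ ^ 2) + W k (Real.sin θ ^ 2)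
      = 2 * Real.cos (2 * (k+1) * θ)) ∧ (W (k+2) (Real.sin θ ^ 2) + W (k+1) (Real.sin θ ^ 2)
      = 2 * Real.cos (2 * (k+2) * θ)) := by
    intro k
    induction k with
    | zero =>
      constructor
      · rw [w0, w1]; norm_num; linarith
      · rw [W_rec, w0, w1, hc]
        have : 2 * ((0:ℕ) + 2 : ℝ) * θ = 2 * (2 * θ) := by push_cast; ring
        rw [this, Real.cos_two_mul (2 * θ)]
        have : 1 - 4 * Real.sin θ ^ 2 = 2 * Real.cos (2 * θ) - 1 := by linarith
        rw [this]; ring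
    | succ k ih =>
      refine ⟨?_, ?_⟩
      · have := ih.2
        push_cast
        rw [this]; ring_nf
      · have a := W_rec (k+1) (Real.sin θ ^ 2)
        have b := W_rec k (Real.sin θ ^ 2)
        have e1 : 2 * (((k+1 : ℕ) : ℝ) + 2) * θ = 2 * (k+2) * θ + 2 * θ := by push_cast; ring
        have e2 : 2 * ((k : ℝ) + 1) * θ = 2 * (k+2) * θ - 2 * θ := by ring
        have i1 := ih.1
        have i2 := ih.2
        rw [e2, Real.cos_sub] at i1
        rw [e1, Real.cos_add]
        rw [hc] at a b
        show W (k+1+2) _ + W (k+2) _ = _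
        rw [show k+1+1 = k+2 from rfl] at a
        linear_combination a + b - i1 + 2 * Real.cos (2 * θ) * i2
  exact (key k).1

lemma t_eq (k i : ℕ) (h : i ≤ k + 1) :
    (-1) ^ (k+1) * tCoeff (k+1) i = (v (k+1) i + v k i) / 2 := by
  unfold tCoeff v
  rw [if_neg (by omega)]
  obtain ⟨j, hj⟩ : ∃ j, k + 1 = i + j := ⟨k + 1 - i, by omega⟩
  have hs : (-1 : ℝ) ^ (k+1) * (-1) ^ (k+1-i) = (-1) ^ i := by
    rw [hj, Nat.add_sub_cancel_left, pow_add, mul_assoc, ← mul_pow]; simp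
  have hch : (k+1+i).choose (k+1-i) = (k+1+i).choose (2*i) := by
    apply Nat.choose_symm_of_eq_add; omega
  have hk : ((k+i).choose (2*i) : ℝ) * (k + 1 + i) = (k+1+i).choose (2*i) * (k + 1 - i) := by
    have := Nat.choose_mul_succ_eq (k+i) (2*i)
    have e : k + i + 1 - 2 * i = j := by omega
    rw [e] at this
    have hj' : (j : ℝ) = k + 1 - i := by
      have : ((k + 1 : ℕ) : ℝ) = ((i + j : ℕ) : ℝ) := by rw [hj]
      push_cast at this; linarith
    rw [← hj', show k + 1 + i = k + i + 1 by ring]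
    have t : (((k+i).choose (2*i) * (k+i+1) : ℕ) : ℝ) = ((k+i+1).choose (2*i) * j : ℕ) := by
      rw [this]
    push_cast at t
    linarith
  rw [hch]
  have hp : (0:ℝ) < k + 1 + i := by positivity
  have hk' : ((k+i).choose (2*i) : ℝ) = (k+1+i).choose (2*i) * (k + 1 - i) / (k + 1 + i) := by
    rw [eq_div_iff hp.ne', hk]
  rw [hk', ← hs, show (2:ℝ) ^ (2*i) = 4 ^ i by rw [pow_mul]; norm_num]
  push_cast
  field_simp
  ring

lemma t_sum (θ : ℝ) (k : ℕ) :
    ∑ i ∈ Finset.range (k+1), (-1) ^ k * tCoeff k i * Real.sin θ ^ (2 * i) =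
      if k = 0 then 1/2 else Real.cos (2 * k * θ) := by
  rcases k with _ | k
  · simp [tCoeff]
  · rw [if_neg (by omega)]
    have : ∀ i ∈ Finset.range (k+1+1), (-1) ^ (k+1) * tCoeff (k+1) i * Real.sin θ ^ (2 * i)
      = (v (k+1) i * (Real.sin θ^2)^i + v k i * (Real.sin θ^2)^i) / 2 := by
      intro i hi
      rw [t_eq k i (by simp at hi; omega), pow_mul]; ring
    rw [Finset.sum_congr rfl this, ← Finset.sum_div, Finset.sum_add_distrib, W_ext _ _ _ le_rfl,
      W_ext _ _ _ (by omega), W_cos]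
    push_cast; ring

end CircB
namespace CircC
open Polynomial UpperHalfPlane

noncomputable def Q : ℕ → ℂ[X]
  | 0 => Polynomial.C (1/2) * (1 + X)
  | (k+1) => X * (derivative (Q k)) - X * (X * derivative (Q k)) + X * (Polynomial.C ((k:ℂ)+1) * Q k)

lemma Q_succ (k : ℕ) : Q (k+1) = X * (derivative (Q k)) - X * (X * derivative (Q k))
    + X * (Polynomial.C ((k:ℂ)+1) * Q k) := rfl

lemma Q_one : Q 1 = X := by
  rw [Q_succ, Q]
  simp only [derivative_mul, derivative_C, derivative_add, derivative_one, derivative_X]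
  have : (Polynomial.C (1/2) : ℂ[X]) + Polynomial.C (1/2) = 1 := by
    rw [← Polynomial.C_add]; norm_num
  simp only [CharP.cast_eq_zero, zero_add, Polynomial.C_1]
  linear_combination (X : ℂ[X]) * this

lemma Q_coeff (k l : ℕ) : (Q (k+1)).coeff l = (CircE.F (k+1) l : ℂ) := by
  induction k generalizing l with
  | zero =>
    rw [zero_add, Q_one, CircE.F_one, coeff_X]
    simp [eq_comm]
  | succ k ih =>
    rw [Q_succ]
    rcases l with _ | l
    · simp [CircE.F_zero]
    · have h := CircE.F_rec (k+1) l
      have h' : ((CircE.F (k+1+1) (l+1) + l * CircE.F (k+1) l : ℕ) : ℂ) =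
        ((l+1) * CircE.F (k+1) (l+1) + (k+1+1) * CircE.F (k+1) l : ℕ) := by rw [h]
      push_cast at h'
      have hx : (X * derivative (Q (k+1))).coeff l = l * (CircE.F (k+1) l : ℂ) := by
        rcases l with _ | l
        · simp
        · rw [coeff_X_mul, coeff_derivative, ih]; push_cast; ring
      rw [coeff_add, coeff_sub, coeff_X_mul, coeff_X_mul, coeff_X_mul, hx, coeff_derivative,
        coeff_C_mul, ih, ih]
      push_cast
      linear_combination -h'

lemma Q_eval (k : ℕ) (w : ℂ) : (Q (k+1)).eval w =
    ∑ l ∈ Finset.range (k+3), (CircE.F (k+1) l : ℂ) * w ^ l := by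
  rw [eval_eq_sum_range' (n := k+3)]
  · simp [Q_coeff]
  · rw [Nat.lt_iff_add_one_le]
    have : (Q (k+1)).natDegree ≤ k + 2 := by
      rw [natDegree_le_iff_coeff_eq_zero]
      intro N hN
      rw [Q_coeff, CircE.F_large _ _ (by omega)]; simp
    omega

lemma w_ne_one {z : ℂ} (hz : z ∈ upperHalfPlaneSet) :
    1 - Complex.exp (2 * π * Complex.I * z) ≠ 0 := by
  intro h
  have h1 := UpperHalfPlane.norm_exp_two_pi_I_lt_one ⟨z, hz⟩
  have h2 : Complex.exp (2 * π * Complex.I * z) = 1 := (sub_eq_zero.mp h).symm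
  simp [h2] at h1

lemma iter_cot (k : ℕ) : Set.EqOn
    (iteratedDerivWithin k (fun x : ℂ ↦ π * Complex.cot (π * x)) upperHalfPlaneSet)
    (fun z => -(2 * π * Complex.I) ^ (k+1) * (Q k).eval (Complex.exp (2 * π * Complex.I * z)) *
      ((1 - Complex.exp (2 * π * Complex.I * z)) ^ (k+1))⁻¹) upperHalfPlaneSet := by
  induction k with
  | zero =>
    intro z hz
    have h1 := w_ne_one hz
    simp only [iteratedDerivWithin_zero, Q, Complex.cot_pi_eq_exp_ratio]
    simp only [eval_mul, eval_C, eval_add, eval_one, eval_X, zero_add, pow_one]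
    field_simp
    rw [Complex.I_sq]; ring
  | succ k ih =>
    intro z hz
    have h1 := w_ne_one hz
    rw [iteratedDerivWithin_succ, derivWithin_congr ih (ih hz),
      derivWithin_of_isOpen isOpen_upperHalfPlaneSet hz]
    set c : ℂ := 2 * π * Complex.I with hc
    have hw : HasDerivAt (fun z : ℂ => Complex.exp (c * z)) (Complex.exp (c * z) * (c * 1)) z :=
      ((hasDerivAt_id z).const_mul c).cexp
    have hq := ((Q k).hasDerivAt (Complex.exp (c * z))).comp z hw
    have hd := ((hw.const_sub 1).pow (k+1)).inv (pow_ne_zero _ h1)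
    have := ((hq.const_mul (-c ^ (k+1))).mul hd).deriv
    refine (Eq.trans ?_ this).trans ?_
    · rfl
    · simp only [Function.comp, Pi.pow_apply, Pi.inv_apply, Q_succ]
      simp only [eval_add, eval_sub, eval_mul, eval_X, eval_C]
      generalize Complex.exp (c * z) = w at *
      have e : k + 1 - 1 = k := by omega
      simp only [e]
      push_cast
      field_simp
      ring

lemma tsum_upper (k : ℕ) {z : ℂ} (hz : z ∈ upperHalfPlaneSet) :
    (k + 1).factorial * ∑' n : ℤ, 1 / (z + n) ^ (k + 2) =
     (-(2 * π * Complex.I)) ^ (k+2) * (Q (k+1)).eval (Complex.exp (2 * π * Complex.I * z)) *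
      ((1 - Complex.exp (2 * π * Complex.I * z)) ^ (k+2))⁻¹ := by
  have h := iteratedDerivWithin_cot_pi_mul_eq_mul_tsum_div_pow (k := k+1) (by omega) hz
  rw [iter_cot (k+1) hz] at h
  have hs : ((-1 : ℂ) ^ (k+1)) * (-1) ^ (k+1) = 1 := by rw [← mul_pow]; simp
  rw [neg_pow (2 * π * Complex.I), pow_succ (-1 : ℂ) (k+1)]
  simp only [show k + 1 + 1 = k + 2 from rfl] at h
  generalize (∑' n : ℤ, 1 / (z + n) ^ (k + 2)) = S at *
  linear_combination (-1 : ℂ) ^ (k+1) * (-h) - (k + 1).factorial * S * hs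

lemma summ_real (k : ℕ) (x : ℝ) : Summable (fun n : ℤ => 1 / |x + n| ^ (k+2)) := by
  have h := (Real.summable_one_div_int_add_rpow x (k+2)).mpr (by linarith [Nat.cast_nonneg (α := ℝ) k])
  refine h.congr fun n => ?_
  rw [add_comm]
  have : ((k:ℝ) + 2) = ((k + 2 : ℕ) : ℝ) := by push_cast; ring
  rw [this, Real.rpow_natCast]

lemma tsum_real (k : ℕ) (x : ℝ) (hx : ∀ n : ℤ, x + n ≠ 0)
    (hw : 1 - Complex.exp (2 * π * Complex.I * x) ≠ 0) :
    (k + 1).factorial * ∑' n : ℤ, 1 / ((x : ℂ) + n) ^ (k + 2) =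
     (-(2 * π * Complex.I)) ^ (k+2) * (Q (k+1)).eval (Complex.exp (2 * π * Complex.I * x)) *
      ((1 - Complex.exp (2 * π * Complex.I * x)) ^ (k+2))⁻¹ := by
  have hz : Tendsto (fun t : ℝ => (x : ℂ) + t * Complex.I) (nhdsWithin 0 (Set.Ioi 0)) (nhds (x:ℂ)) := by
    have : ContinuousAt (fun t : ℝ => (x : ℂ) + t * Complex.I) 0 := by fun_prop
    have h := this.tendsto
    simp only [Complex.ofReal_zero, zero_mul, add_zero] at h
    exact h.mono_left nhdsWithin_le_nhds
  have h1 : Tendsto (fun t : ℝ => ∑' n : ℤ, 1 / ((x : ℂ) + t * Complex.I + n) ^ (k + 2))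
      (nhdsWithin 0 (Set.Ioi 0)) (nhds (∑' n : ℤ, 1 / ((x : ℂ) + n) ^ (k + 2))) := by
    refine tendsto_tsum_of_dominated_convergence (summ_real k x) ?_ ?_
    · intro n
      have hn : ((x : ℂ) + n) ^ (k+2) ≠ 0 := pow_ne_zero _ (by exact_mod_cast hx n)
      exact Tendsto.div tendsto_const_nhds ((hz.add_const _).pow _) hn
    · refine Filter.Eventually.of_forall fun t n => ?_
      rw [norm_div, norm_one, norm_pow]
      have hpos : 0 < |x + n| := abs_pos.mpr (hx n)
      have : |x + n| ≤ ‖(x : ℂ) + t * Complex.I + n‖ := by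
        have := Complex.abs_re_le_norm ((x : ℂ) + t * Complex.I + n)
        simpa using this
      gcongr
  have h2 : ContinuousAt (fun z : ℂ =>
     (-(2 * π * Complex.I)) ^ (k+2) * (Q (k+1)).eval (Complex.exp (2 * π * Complex.I * z)) *
      ((1 - Complex.exp (2 * π * Complex.I * z)) ^ (k+2))⁻¹) (x:ℂ) := by
    refine ContinuousAt.mul ?_ (ContinuousAt.inv₀ (by fun_prop) (pow_ne_zero _ hw))
    refine ContinuousAt.mul continuousAt_const ?_
    exact ((Q (k+1)).continuous.comp (by fun_prop)).continuousAt
  have h3 := h2.tendsto.comp hz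
  refine tendsto_nhds_unique (h1.const_mul _) (h3.congr' ?_)
  filter_upwards [self_mem_nhdsWithin] with t ht
  have ht' : (x : ℂ) + t * Complex.I ∈ upperHalfPlaneSet := by simpa using ht
  exact (tsum_upper k ht').symm

end CircC
namespace CircD

noncomputable def cc (θ : ℝ) (k : ℕ) : ℝ := if k = 0 then 1/2 else Real.cos (2 * k * θ)

lemma a_sum (n : ℕ) (θ : ℝ) (hs : Real.sin θ ≠ 0) :
    ∑ i ∈ Finset.Icc 1 n, aCoeff n i / Real.sin θ ^ (2 * i) =
      2 * (∑ l ∈ Finset.Icc 1 n, (circEulerian (2*n) l : ℝ) * cc θ (n - l)) /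
        Real.sin θ ^ (2 * n) := by
  unfold aCoeff
  simp_rw [mul_div_assoc, Finset.sum_div, Finset.mul_sum]
  rw [Finset.sum_comm' (t' := Finset.Icc 1 n) (s' := fun l => Finset.Icc l n)
    (by intro x y; simp only [Finset.mem_Icc]; omega)]
  refine Finset.sum_congr rfl fun l hl => ?_
  rw [Finset.mem_Icc] at hl
  unfold cc
  rw [← CircB.t_sum θ (n - l), Finset.mul_sum, Finset.sum_div, Finset.mul_sum]
  refine Finset.sum_bij' (fun i _ => n - i) (fun j _ => n - j) ?_ ?_ ?_ ?_ ?_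
  · intro i hi; simp only [Finset.mem_Icc, Finset.mem_range] at *; omega
  · intro i hi; simp only [Finset.mem_Icc, Finset.mem_range] at *; omega
  · intro i hi; simp only [Finset.mem_Icc, Finset.mem_range] at *; omega
  · intro i hi; simp only [Finset.mem_Icc, Finset.mem_range] at *; omega
  · intro i hi
    simp only [Finset.mem_Icc] at hi
    have : Real.sin θ ^ (2 * n) = Real.sin θ ^ (2 * i) * Real.sin θ ^ (2 * (n - i)) := by
      rw [← pow_add]; congr 1; omega
    rw [this]
    field_simp

lemma fold_sum (n : ℕ) (g : ℕ → ℂ) : ∑ l ∈ Finset.range (2*n+1), g l =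
    ∑ l ∈ Finset.range n, (g l + g (2*n-l)) + g n := by
  rw [show 2 * n + 1 = n + (n + 1) by ring, Finset.sum_range_add, Finset.sum_range_succ',
    Finset.sum_add_distrib]
  rw [← Finset.sum_range_reflect (fun x => g (n + (x+1)))]
  have : ∑ j ∈ Finset.range n, g (n + (n - 1 - j + 1)) = ∑ l ∈ Finset.range n, g (2*n-l) := by
    refine Finset.sum_congr rfl fun j hj => ?_
    rw [Finset.mem_range] at hj
    congr 1; omega
  rw [this]
  simp; ring

lemma e_sum (p : ℕ) (θ : ℝ) :
    ∑ l ∈ Finset.range (2*(p+1)+1), (CircE.F (2*p+1) l : ℂ) * Complex.exp (2 * Complex.I * θ) ^ l =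
    Complex.exp (2 * Complex.I * θ) ^ (p+1) *
      ((2 * ∑ l ∈ Finset.Icc 1 (p+1), (circEulerian (2*(p+1)) l : ℝ) * cc θ (p + 1 - l) : ℝ) : ℂ) := by
  have hC : ∀ l, circEulerian (2*(p+1)) l = CircE.F (2*p+1) l :=
    fun l => CircE.circEulerian_eq (2*p+1) l
  simp_rw [hC]
  rw [fold_sum, Finset.range_eq_Ico, Finset.sum_eq_sum_Ico_succ_bot (by omega)]
  rw [CircE.F_zero, CircE.F_symm (2*p) (2*(p+1)-0) 0 (by omega), CircE.F_zero]
  rw [show Finset.Icc 1 (p+1) = insert (p+1) (Finset.Ico (0+1) (p+1)) by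
    ext x; simp only [Finset.mem_Icc, Finset.mem_insert, Finset.mem_Ico]; omega]
  rw [Finset.sum_insert (by simp)]
  rw [mul_add (2 : ℝ), Finset.mul_sum]
  simp only [Complex.ofReal_add, Complex.ofReal_sum, Complex.ofReal_mul, Complex.ofReal_natCast,
    Complex.ofReal_ofNat, Nat.cast_zero]
  rw [mul_add (Complex.exp (2 * Complex.I * θ) ^ (p+1)), Finset.mul_sum]
  simp only [Nat.sub_self, zero_mul, zero_add]
  rw [add_comm]
  congr 1
  · simp [cc]; ring
  · refine Finset.sum_congr rfl fun l hl => ?_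
    rw [Finset.mem_Ico] at hl
    obtain ⟨d, hd⟩ : ∃ d, p + 1 = l + d := ⟨p + 1 - l, by omega⟩
    have hd0 : d ≠ 0 := by omega
    have e1 : p + 1 - l = d := by omega
    have e2 : 2 * (p+1) - l = l + d + d := by omega
    rw [CircE.F_symm (2*p) (2*(p+1)-l) l (by omega), e1, e2, hd]
    simp only [cc, if_neg hd0]
    push_cast
    have h2 : 2 * Complex.cos (2 * d * θ) * Complex.exp (2 * Complex.I * θ) ^ d
        = Complex.exp (2 * Complex.I * θ) ^ (d + d) + 1 := by
      rw [Complex.two_cos, ← Complex.exp_nat_mul, ← Complex.exp_nat_mul, add_mul,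
        ← Complex.exp_add, ← Complex.exp_add]
      congr 1
      · congr 1; push_cast; ring
      · rw [← Complex.exp_zero]; congr 1; ring
    rw [pow_add, pow_add] at *
    linear_combination (-(CircE.F (2*p+1) l : ℂ) * Complex.exp (2 * Complex.I * θ) ^ l) * h2

lemma one_sub_w (θ : ℝ) : 1 - Complex.exp (2 * Complex.I * θ) =
    -2 * Complex.I * (Real.sin θ : ℂ) * Complex.exp (Complex.I * θ) := by
  rw [Complex.ofReal_sin, Complex.sin]
  have h1 : Complex.exp (2 * Complex.I * θ) = Complex.exp (Complex.I * θ) * Complex.exp (Complex.I * θ) := by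
    rw [← Complex.exp_add]; congr 1; ring
  have h2 : Complex.exp (-θ * Complex.I) * Complex.exp (Complex.I * θ) = 1 := by
    rw [← Complex.exp_add, ← Complex.exp_zero]; congr 1; ring
  have h3 : Complex.exp (θ * Complex.I) = Complex.exp (Complex.I * θ) := by rw [mul_comm]
  rw [h1, h3]
  linear_combination (-1) * h2 + (Complex.exp (-θ * Complex.I) - Complex.exp (Complex.I * θ)) *
    Complex.exp (Complex.I * θ) * Complex.I_sq

lemma tsum_sin (n : ℕ) (hn : 1 ≤ n) (x : ℝ) (hs : Real.sin (x * π) ≠ 0) :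
    ∑' j : ℤ, 1 / ((x : ℂ) + j) ^ (2 * n) = (π : ℂ) ^ (2 * n) / ((2 * n - 1).factorial : ℂ) *
      ∑ i ∈ Finset.Icc 1 n, (aCoeff n i : ℂ) / (Real.sin (x * π) : ℂ) ^ (2 * i) := by
  obtain ⟨p, rfl⟩ : ∃ p, n = p + 1 := ⟨n - 1, by omega⟩
  have hsC : (Real.sin (x * π) : ℂ) ≠ 0 := by exact_mod_cast hs
  have hx : ∀ j : ℤ, x + j ≠ 0 := by
    intro j hj
    apply hs
    have : x = ((-j : ℤ) : ℝ) := by push_cast; linarith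
    rw [this, Real.sin_int_mul_pi]
  have hexp : Complex.exp (2 * π * Complex.I * x) = Complex.exp (2 * Complex.I * (x * π : ℝ)) := by
    congr 1; push_cast; ring
  have hw := one_sub_w (x * π)
  have h := CircC.tsum_real (2*p) x hx (by
    rw [hexp, hw]
    simp only [ne_eq, mul_eq_zero, neg_eq_zero, Complex.exp_ne_zero, Complex.I_ne_zero, hsC,
      OfNat.ofNat_ne_zero, or_self, not_false_eq_true])
  have ha := congrArg (fun t : ℝ => (t : ℂ)) (a_sum (p+1) (x * π) hs)
  simp only [Complex.ofReal_sum, Complex.ofReal_div, Complex.ofReal_pow] at ha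
  have he := e_sum p (x * π)
  rw [CircC.Q_eval, hexp, show 2 * p + 3 = 2 * (p+1) + 1 by ring, he, hw] at h
  rw [ha]
  rw [show 2 * (p+1) - 1 = 2 * p + 1 by omega]
  have hf : ((2*p+1).factorial : ℂ) ≠ 0 := by exact_mod_cast Nat.factorial_ne_zero _
  rw [show 2 * (p+1) = 2 * p + 2 by ring] at *
  generalize (∑' j : ℤ, 1 / ((x : ℂ) + j) ^ (2 * p + 2)) = S at *
  generalize ((2 * ∑ l ∈ Finset.Icc 1 (p+1), (circEulerian (2*p+2) l : ℝ) * cc (x * π) (p + 1 - l) : ℝ) : ℂ) = T at *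
  have hE : Complex.exp (2 * Complex.I * (x * π : ℝ)) ^ (p+1)
      = Complex.exp (Complex.I * (x * π : ℝ)) ^ (2 * p + 2) := by
    rw [← Complex.exp_nat_mul, ← Complex.exp_nat_mul]; congr 1; push_cast; ring
  rw [hE] at h
  have hne := Complex.exp_ne_zero (Complex.I * (x * π : ℝ))
  generalize Complex.exp (Complex.I * (x * π : ℝ)) = u at *
  have h2 : (-(2 * (π:ℂ) * Complex.I)) ^ (2 * p + 2) * (u ^ (2 * p + 2) * T) *
      ((-2 * Complex.I * (Real.sin (x * π) : ℂ) * u) ^ (2 * p + 2))⁻¹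
      = π ^ (2 * p + 2) * (T / (Real.sin (x * π) : ℂ) ^ (2*p+2)) := by
    have e : -(2 * (π:ℂ) * Complex.I) = (-2 * Complex.I) * π := by ring
    have hI : (-2 * Complex.I) ≠ 0 := by simp
    rw [e, mul_pow (-2 * Complex.I) (π:ℂ), mul_pow _ u, mul_pow _ (Real.sin (x * π) : ℂ)]
    generalize -2 * Complex.I = c at *
    field_simp
  rw [h2] at h
  field_simp
  rw [mul_comm S]
  rw [h]
  field_simp

end CircD

namespace CircF

lemma hur (n : ℕ) (hn : 1 ≤ n) (x : ℝ) :
    HurwitzZeta.hurwitzZetaEven (x : UnitAddCircle) ((2 * n : ℕ) : ℂ) =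
      (∑' j : ℤ, 1 / ((x : ℂ) + j) ^ (2 * n)) / 2 := by
  have h := HurwitzZeta.hasSum_int_hurwitzZetaEven x (s := ((2 * n : ℕ) : ℂ)) (by
    rw [Complex.natCast_re]
    exact_mod_cast (by omega : 1 < 2 * n))
  rw [← h.tsum_eq, tsum_div_const]
  congr 1
  refine tsum_congr fun j => ?_
  rw [Complex.cpow_natCast, ← Complex.ofReal_pow, pow_mul, sq_abs, ← pow_mul]
  push_cast
  rw [add_comm]

end CircF

/-- For an even Dirichlet character `χ` mod `N` (`N > 2`) and `n ≥ 1`,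
`L(2n,χ) = (π^{2n} / (2(2n-1)! N^{2n})) ∑_{i=1}^{n} a_{n,i} L_{ℤ/Nℤ}(i,χ)`, where
`L_{ℤ/Nℤ}(i,χ) = ∑_{m=1}^{N-1} χ(m)/sin^{2i}(mπ/N)`. -/
theorem LFunction_even_eq_graph_LFunction_sum (N : ℕ) [NeZero N] (hN : 2 < N)
    (χ : DirichletCharacter ℂ N) (heven : χ (-1) = 1) (n : ℕ) (hn : 1 ≤ n) :
    DirichletCharacter.LFunction χ ((2 * n : ℕ) : ℂ) =
      ((π : ℂ) ^ (2 * n) / (2 * (Nat.factorial (2 * n - 1) : ℂ) * (N : ℂ) ^ (2 * n))) *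
        ∑ i ∈ Finset.Icc 1 n, (aCoeff n i : ℂ) *
          ∑ m ∈ Finset.Icc 1 (N - 1),
            χ (m : ZMod N) / ((Real.sin ((m : ℝ) * π / N) : ℂ)) ^ (2 * i) := by
  have hN0 : (N : ℂ) ≠ 0 := by exact_mod_cast NeZero.ne N
  have hev : Function.Even (χ : ZMod N → ℂ) := by
    intro a
    rw [show -a = (-1) * a by ring, map_mul, heven, one_mul]
  have h0 : χ 0 = 0 := by
    apply MulChar.map_nonunit
    have : Fact (1 < N) := ⟨by omega⟩
    exact not_isUnit_zero
  have hsum : ∀ f : ZMod N → ℂ, f 0 = 0 →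
      ∑ j : ZMod N, f j = ∑ m ∈ Finset.Icc 1 (N - 1), f (m : ZMod N) := by
    intro f hf
    rw [← Finset.sum_erase Finset.univ hf]
    refine Finset.sum_bij' (fun j _ => j.val) (fun m _ => (m : ZMod N)) ?_ ?_ ?_ ?_ ?_
    · intro j hj
      have h1 := ZMod.val_lt j
      have h2 : j.val ≠ 0 := by
        simpa using hj
      rw [Finset.mem_Icc]; omega
    · intro m hm
      rw [Finset.mem_Icc] at hm
      simp only [Finset.mem_erase, Finset.mem_univ, and_true, ne_eq, ZMod.natCast_eq_zero_iff]
      intro hd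
      have := Nat.le_of_dvd (by omega) hd
      omega
    · intro j _; simp
    · intro m hm
      rw [Finset.mem_Icc] at hm
      exact ZMod.val_cast_of_lt (by omega)
    · intro j _; simp
  have hterm : ∀ m ∈ Finset.Icc 1 (N - 1),
      χ (m : ZMod N) * HurwitzZeta.hurwitzZetaEven (ZMod.toAddCircle (m : ZMod N)) ((2 * n : ℕ) : ℂ)
      = (π : ℂ) ^ (2 * n) / (2 * (Nat.factorial (2 * n - 1) : ℂ)) *
        ∑ i ∈ Finset.Icc 1 n, (aCoeff n i : ℂ) *
          (χ (m : ZMod N) / ((Real.sin ((m : ℝ) * π / N) : ℂ)) ^ (2 * i)) := by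
    intro m hm
    rw [Finset.mem_Icc] at hm
    have hNpos : (0 : ℝ) < N := by exact_mod_cast (by omega : 0 < N)
    have hmpos : (0 : ℝ) < m := by exact_mod_cast (by omega : 0 < m)
    have hmN : (m : ℝ) < N := by exact_mod_cast (by omega : m < N)
    have hx : (m : ℝ) / N * π = (m : ℝ) * π / N := by ring
    have hs : Real.sin ((m : ℝ) / N * π) ≠ 0 := by
      apply ne_of_gt
      apply Real.sin_pos_of_pos_of_lt_pi
      · positivity
      · have : (m : ℝ) / N < 1 := by rw [div_lt_one hNpos]; exact hmN
        nlinarith [Real.pi_pos]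
    rw [ZMod.toAddCircle_natCast, CircF.hur n hn, CircD.tsum_sin n hn _ hs, hx]
    rw [Finset.mul_sum, Finset.sum_div, Finset.mul_sum, Finset.mul_sum]
    refine Finset.sum_congr rfl fun i _ => ?_
    field_simp
  rw [DirichletCharacter.LFunction, ZMod.LFunction_def_even hev, hsum _ (by rw [h0, zero_mul]),
    Finset.sum_congr rfl hterm, ← Finset.mul_sum, Finset.sum_comm, Complex.cpow_neg,
    Complex.cpow_natCast]
  simp_rw [← Finset.mul_sum]
  generalize (∑ i ∈ Finset.Icc 1 n, (aCoeff n i : ℂ) *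
    ∑ m ∈ Finset.Icc 1 (N - 1),
      χ (m : ZMod N) / ((Real.sin ((m : ℝ) * π / N) : ℂ)) ^ (2 * i)) = S
  field_simp
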